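/- Let {l₁, l₂, l₃, l₄, l₅} be five distinct lines in Pic S₈ that pairwise intersect in 1 (an A₄⁸(1)-polytope). Then there is exactly one 4-element subset of {l₁, …, l₅} whose lines form a cornered A₃⁸(1)-polytope. -/

import Mathlib

/-!
Picard lattice of the degree 1 del Pezzo surface S₈:
Pic S₈ = ℤh ⊕ ℤe₁ ⊕ ⋯ ⊕ ℤe₈ ≅ ℤ⁹, with intersection pairing
h·h = 1, h·eᵢ = 0, eᵢ·eⱼ = −δᵢⱼ, and canonical class K = −3h + e₁ + ⋯ + e₈.
-/

namespace DelPezzo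

/-- The Picard lattice `Pic S₈ ≅ ℤ⁹`; coordinate `0` is the `h`-coordinate and
coordinates `1,…,8` are the `e₁,…,e₈`-coordinates. -/
abbrev Pic : Type := Fin 9 → ℤ

/-- The intersection pairing on `Pic S₈` (signature `(1,-8)`). -/
def inter (x y : Pic) : ℤ := x 0 * y 0 - ∑ i : Fin 8, x i.succ * y i.succ

/-- The canonical class `K = -3h + e₁ + ⋯ + e₈`. -/
def K : Pic := fun i => if i = 0 then -3 else 1

/-- A line: a class `l` with `l·l = -1` and `l·K = -1`. -/
def IsLine (l : Pic) : Prop := inter l l = -1 ∧ inter l K = -1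

/-- A finite set of lines is cornered if some line has intersection `0` with all of them. -/
def IsCornered (T : Finset Pic) : Prop := ∃ m : Pic, IsLine m ∧ ∀ x ∈ T, inter m x = 0

/-- The intersection pairing as a bilinear form. -/
def interForm : LinearMap.BilinForm ℤ Pic :=
  LinearMap.mk₂ ℤ inter
    (fun x y z => by simp only [inter, Pi.add_apply, add_mul, Finset.sum_add_distrib]; ring)
    (fun c x y => by
      simp only [inter, Pi.smul_apply, smul_eq_mul, mul_sub, Finset.mul_sum, mul_assoc])
    (fun x y z => by simp only [inter, Pi.add_apply, mul_add, Finset.sum_add_distrib]; ring)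
    (fun c x y => by
      simp only [inter, Pi.smul_apply, smul_eq_mul, mul_sub, Finset.mul_sum, mul_left_comm])

theorem interForm_apply (x y : Pic) : interForm x y = inter x y := rfl

theorem inter_comm (x y : Pic) : inter x y = inter y x := by
  simp only [inter, mul_comm]

theorem inter_K (x : Pic) : inter x K = -3 * x 0 - ∑ i : Fin 8, x i.succ := by
  simp [inter, K, Fin.succ_ne_zero, mul_comm]

theorem inter_K_K : inter K K = 1 := by decide

/-- `K` is a characteristic vector of the lattice. -/
theorem even_inter_self_add_inter_K (x : Pic) : Even (inter x x + inter x K) := by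
  have h : inter x x + inter x K =
      x 0 * (x 0 + 1) - 4 * x 0 - ∑ i : Fin 8, x i.succ * (x i.succ + 1) := by
    rw [inter_K, inter]
    simp only [mul_add, mul_one, Finset.sum_add_distrib]
    ring
  rw [h]
  exact ((Int.even_mul_succ_self _).sub (.mul_right (by decide) _)).sub
    (Finset.even_sum _ fun i _ => Int.even_mul_succ_self _)

/-- The intersection pairing is negative definite on the orthogonal complement of `K`. -/
theorem eq_zero_of_inter_self_eq_zero {v : Pic} (hK : inter v K = 0) (hv : inter v v = 0) :
    v = 0 := by
  have hcs := sq_sum_le_card_mul_sum_sq (s := Finset.univ) (f := fun i : Fin 8 => v i.succ)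
  rw [inter_K] at hK
  have hsq : ∑ i : Fin 8, v i.succ ^ 2 = v 0 ^ 2 := by
    simp only [inter, ← pow_two] at hv
    linarith
  rw [show ∑ i : Fin 8, v i.succ = -3 * v 0 by linarith, hsq] at hcs
  simp only [Finset.card_univ, Fintype.card_fin] at hcs
  have h0 : v 0 = 0 := by
    push_cast at hcs
    exact pow_eq_zero_iff two_ne_zero |>.1 (le_antisymm (by nlinarith) (sq_nonneg _))
  rw [h0, zero_pow two_ne_zero, Finset.sum_eq_zero_iff_of_nonneg fun _ _ => sq_nonneg _] at hsq
  funext i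
  refine Fin.cases h0 (fun j => ?_) i
  simpa using hsq j (Finset.mem_univ j)

/-- Adding `K` to the lines turns them into roots of the `E₈` lattice `K^⊥`. -/
theorem inter_add_K_add_K {x y : Pic} (hx : inter x K = -1) (hy : inter y K = -1) :
    inter (x + K) (y + K) = inter x y - 1 := by
  have hy' := inter_comm K y
  simp only [← interForm_apply] at *
  have := inter_K_K
  simp only [← interForm_apply] at this
  simp only [map_add, LinearMap.add_apply]
  linarith

theorem inter_add_K_K {x : Pic} (hx : inter x K = -1) : inter (x + K) K = 0 := by
  have := inter_K_K
  simp only [← interForm_apply] at *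
  simp only [map_add, LinearMap.add_apply]
  linarith

theorem inter_sum_add_K_K {A : Finset Pic} (hA : ∀ x ∈ A, IsLine x) :
    inter (∑ x ∈ A, (x + K)) K = 0 := by
  rw [← interForm_apply, map_sum, LinearMap.sum_apply]
  exact Finset.sum_eq_zero fun x hx => inter_add_K_K (hA x hx).2

/-- A self-orthogonal family of vectors over a field spans at most half of the dimension. -/
theorem two_mul_card_le_of_dotProduct_eq_zero {ι n F : Type*} [Field F] [Fintype ι] [Fintype n]
    {v : ι → n → F} (hv : LinearIndependent F v) (h : ∀ i j, v i ⬝ᵥ v j = 0) :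
    2 * Fintype.card ι ≤ Fintype.card n := by
  classical
  have hmul : Matrix.of v * (Matrix.of v).transpose = 0 := by
    ext i j
    exact h i j
  have hrank : (Matrix.of v).rank = Fintype.card ι := LinearIndependent.rank_matrix hv
  have := Matrix.rank_add_rank_le_card_of_mul_eq_zero hmul
  rw [Matrix.rank_transpose, hrank] at this
  omega

/-- The roots attached to pairwise intersecting lines are pairwise orthogonal. -/
theorem inter_sum_add_K_sum_add_K {S A B : Finset Pic} (hline : ∀ x ∈ S, IsLine x)
    (hint : ∀ x ∈ S, ∀ y ∈ S, x ≠ y → inter x y = 1) (hA : A ⊆ S) (hB : B ⊆ S) :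
    inter (∑ x ∈ A, (x + K)) (∑ y ∈ B, (y + K)) = -2 * (A ∩ B).card := by
  have hroot : ∀ x ∈ A, ∀ y ∈ B, interForm (x + K) (y + K) = if x = y then -2 else 0 := by
    intro x hx y hy
    rw [interForm_apply, inter_add_K_add_K (hline x (hA hx)).2 (hline y (hB hy)).2]
    split_ifs with h
    · rw [← h, (hline x (hA hx)).1]
      norm_num
    · rw [hint x (hA hx) y (hB hy) h, sub_self]
  rw [← interForm_apply]
  simp only [map_sum interForm, LinearMap.sum_apply]
  simp_rw [map_sum]
  rw [Finset.sum_congr rfl fun x hx => Finset.sum_congr rfl (hroot x hx)]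
  simp only [Finset.sum_ite_eq, Finset.sum_ite_mem, Finset.sum_const, nsmul_eq_mul]
  ring

theorem inter_intCast_zmod_two (x y : Pic) :
    ((inter x y : ℤ) : ZMod 2) =
      (fun i => (x i : ZMod 2)) ⬝ᵥ (fun i => (y i : ZMod 2)) := by
  simp [inter, dotProduct, Fin.sum_univ_succ (n := 8), CharTwo.sub_eq_add]

/-- Among five pairwise orthogonal roots, some nonempty subset has sum divisible by two. -/
theorem exists_nonempty_two_smul_eq_sum {S : Finset Pic} (hcard : S.card = 5)
    (hline : ∀ x ∈ S, IsLine x) (hint : ∀ x ∈ S, ∀ y ∈ S, x ≠ y → inter x y = 1) :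
    ∃ T ⊆ S, T.Nonempty ∧ ∃ r : Pic, (2 : ℤ) • r = ∑ x ∈ T, (x + K) := by
  classical
  let v : Pic → Fin 9 → ZMod 2 := fun x i => ((x + K) i : ℤ)
  have hdep : ¬ LinearIndepOn (ZMod 2) v (S : Set Pic) := by
    intro hv
    have := two_mul_card_le_of_dotProduct_eq_zero hv (by
      rintro ⟨x, hx⟩ ⟨y, hy⟩
      simp only [v]
      rw [← inter_intCast_zmod_two, inter_add_K_add_K (hline x hx).2 (hline y hy).2]
      by_cases h : x = y
      · subst h
        rw [(hline x hx).1]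
        decide
      · simp [hint x hx y hy h])
    simp [hcard] at this
  rw [linearIndepOn_finset_iff] at hdep
  push Not at hdep
  obtain ⟨f, hf, a, ha, hfa⟩ := hdep
  refine ⟨S.filter (f · ≠ 0), Finset.filter_subset _ _, ⟨a, by simp [ha, hfa]⟩, ?_⟩
  have hdvd : ∀ i, (2 : ℤ) ∣ (∑ x ∈ S.filter (f · ≠ 0), (x + K)) i := by
    intro i
    rw [← Nat.cast_ofNat, ← ZMod.intCast_zmod_eq_zero_iff_dvd, Finset.sum_apply, Int.cast_sum,
      Finset.sum_filter]
    have hi := congrFun hf i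
    rw [Finset.sum_apply] at hi
    refine Eq.trans ?_ hi
    refine Finset.sum_congr rfl fun x _ => ?_
    have hcases : ∀ c : ZMod 2, c = 0 ∨ c = 1 := by decide
    rcases hcases (f x) with h | h <;> simp [h, v]
  choose r hr using hdvd
  exact ⟨r, funext fun i => (hr i).symm⟩

/-- Four pairwise orthogonal roots whose sum is twice a root come from cornered lines. -/
theorem isCornered_of_two_smul_eq_sum {T : Finset Pic} (hcard : T.card = 4)
    (hline : ∀ x ∈ T, IsLine x) (hint : ∀ x ∈ T, ∀ y ∈ T, x ≠ y → inter x y = 1)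
    {r : Pic} (hr : (2 : ℤ) • r = ∑ x ∈ T, (x + K)) : IsCornered T := by
  have hrr := inter_sum_add_K_sum_add_K hline hint subset_rfl subset_rfl
  have hrK := inter_sum_add_K_K hline
  have hrx : ∀ x ∈ T, inter ((2 : ℤ) • r) (x + K) = -2 := by
    intro x hx
    have := inter_sum_add_K_sum_add_K hline hint subset_rfl (Finset.singleton_subset_iff.2 hx)
    rwa [Finset.sum_singleton, ← hr, Finset.inter_singleton_of_mem hx, Finset.card_singleton,
      Nat.cast_one, mul_one] at this
  rw [Finset.inter_self, hcard, ← hr] at hrr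
  rw [← hr] at hrK
  have hKK := inter_K_K
  have hKr := inter_comm K r
  refine ⟨r - K, ⟨?_, ?_⟩, fun x hx => ?_⟩
  all_goals simp only [← interForm_apply, map_sub, map_smul, LinearMap.sub_apply,
    LinearMap.smul_apply, smul_eq_mul] at *
  · push_cast at hrr
    linarith
  · linarith
  · have h := hrx x hx
    have hxK := (hline x hx).2
    have hKx := inter_comm K x
    simp only [← interForm_apply, map_add] at *
    linarith

/-- The root of a line cornering four lines is half the sum of their roots. -/
theorem IsCornered.exists_two_smul_eq_sum {T : Finset Pic} (hT : IsCornered T)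
    (hcard : T.card = 4) (hline : ∀ x ∈ T, IsLine x)
    (hint : ∀ x ∈ T, ∀ y ∈ T, x ≠ y → inter x y = 1) :
    ∃ r : Pic, (2 : ℤ) • r = ∑ x ∈ T, (x + K) := by
  obtain ⟨m, hm, hmT⟩ := hT
  refine ⟨m + K, sub_eq_zero.1 (eq_zero_of_inter_self_eq_zero ?_ ?_)⟩
  · have h1 := inter_add_K_K hm.2
    have h2 := inter_sum_add_K_K hline
    rw [← interForm_apply] at *
    rw [map_sub, LinearMap.sub_apply, map_smul, LinearMap.smul_apply, h1, h2]
    simp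
  · have h1 := inter_add_K_add_K hm.2 hm.2
    have h2 := inter_sum_add_K_sum_add_K hline hint subset_rfl subset_rfl
    have h3 : inter (m + K) (∑ x ∈ T, (x + K)) = -4 := by
      have hx : ∀ x ∈ T, interForm (m + K) (x + K) = -1 := fun x hx => by
        rw [interForm_apply, inter_add_K_add_K hm.2 (hline x hx).2, hmT x hx, zero_sub]
      rw [← interForm_apply, map_sum, Finset.sum_congr rfl hx]
      simp [hcard]
    have h4 := inter_comm (∑ x ∈ T, (x + K)) (m + K)
    rw [Finset.inter_self, hcard] at h2
    rw [hm.1] at h1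
    generalize ∑ x ∈ T, (x + K) = s at *
    generalize m + K = r at *
    simp only [← interForm_apply] at *
    simp only [map_sub, map_smul, LinearMap.sub_apply, LinearMap.smul_apply, smul_eq_mul]
    push_cast at h2
    linarith

theorem unique_cornered_subset_of_five (S : Finset Pic) (hcard : S.card = 5)
    (hline : ∀ x ∈ S, IsLine x)
    (hint : ∀ x ∈ S, ∀ y ∈ S, x ≠ y → inter x y = 1) :
    ∃! T : Finset Pic, T ⊆ S ∧ T.card = 4 ∧ IsCornered T := by
  obtain ⟨T, hTS, hTne, r, hr⟩ := exists_nonempty_two_smul_eq_sum hcard hline hint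
  have hT4 : T.card = 4 := by
    have hrr := inter_sum_add_K_sum_add_K hline hint hTS hTS
    have hrK := inter_sum_add_K_K fun x hx => hline x (hTS hx)
    obtain ⟨c, hc⟩ := even_inter_self_add_inter_K r
    rw [Finset.inter_self] at hrr
    simp only [← hr, ← interForm_apply, map_smul, LinearMap.smul_apply, smul_eq_mul] at hrr hrK hc
    have := Finset.card_le_card hTS
    have := hTne.card_pos
    omega
  refine ⟨T, ⟨hTS, hT4, isCornered_of_two_smul_eq_sum hT4 (fun x hx => hline x (hTS hx))
    (fun x hx y hy => hint x (hTS hx) y (hTS hy)) hr⟩, ?_⟩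
  rintro U ⟨hUS, hU4, hU⟩
  obtain ⟨q, hq⟩ := hU.exists_two_smul_eq_sum hU4 (fun x hx => hline x (hUS hx))
    fun x hx y hy => hint x (hUS hx) y (hUS hy)
  have hqr := inter_sum_add_K_sum_add_K hline hint hUS hTS
  simp only [← hr, ← hq, ← interForm_apply, map_smul, LinearMap.smul_apply, smul_eq_mul] at hqr
  have hunion := Finset.card_le_card (Finset.union_subset hUS hTS)
  have hinter := Finset.card_union_add_card_inter U T
  have hle := Finset.card_le_card (Finset.inter_subset_left (s₁ := U) (s₂ := T))
  have hUT : U ⊆ T := Finset.inter_eq_left.1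
    (Finset.eq_of_subset_of_card_le Finset.inter_subset_left (by omega))
  exact Finset.eq_of_subset_of_card_le hUT (by omega)

end DelPezzo
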